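/- arXiv:2403.15207 — 5 statements merged into one kernel-verified Lean document; each statement's English description precedes it below -/
import Mathlib

section
/- Let X be a measurable space, P a probability measure on X × {−1,1}, and H a nonempty countable class of measurable functions X → ℝ that is uniformly bounded. Fix ζ > 0, δ ∈ (0,1) and an integer m ≥ 1. Then with P^m-probability at least 1 − δ over an i.i.d. sample (x_1,y_1),…,(x_m,y_m) drawn from P, every h ∈ H satisfies R_rob^ζ(h) ≤ (1/m) ∑_{i=1}^m φ_{2,ζ}(y_i · h(x_i)) + (2/ζ) · R_m(H) + √(log(1/δ)/(2m)). -/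
open MeasureTheory

/-- Surrogate loss `φ_{λ,ζ}(z) = max(0, λ − z/ζ)`. -/
noncomputable def phi (lam ζ z : ℝ) : ℝ := max 0 (lam - z / ζ)

/-- Empirical Rademacher complexity of a class `H` of real-valued functions with
respect to the sample `s = (s_1, …, s_m)`:
`R̂_S(H) = 2^{−m} ∑_{σ ∈ {−1,1}^m} sup_{h ∈ H} (1/m) ∑_i σ_i h(s_i)`. -/
noncomputable def empRad {X : Type*} (H : Set (X → ℝ)) (m : ℕ) (s : Fin m → X) : ℝ :=
  ((2 : ℝ) ^ m)⁻¹ *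
    ∑ σ : Fin m → Bool,
      ⨆ h : H, ((m : ℝ))⁻¹ * ∑ i, (if σ i then (1 : ℝ) else -1) * h.1 (s i)

open ProbabilityTheory

section BoundedReal

theorem integrable_of_abs_le {Ω : Type*} [MeasurableSpace Ω] {μ : Measure Ω} [IsFiniteMeasure μ]
    {f : Ω → ℝ} (hf : Measurable f) {B : ℝ} (hB : ∀ ω, |f ω| ≤ B) : Integrable f μ :=
  Integrable.of_bound hf.aestronglyMeasurable B (Filter.Eventually.of_forall hB)

theorem abs_integral_le_of_abs_le {Ω : Type*} [MeasurableSpace Ω] {μ : Measure Ω}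
    [IsProbabilityMeasure μ] {f : Ω → ℝ} {B : ℝ} (hB : ∀ ω, |f ω| ≤ B) : |∫ ω, f ω ∂μ| ≤ B := by
  simpa using norm_integral_le_of_norm_le_const (μ := μ) (f := f) (Filter.Eventually.of_forall hB)

theorem bddAbove_range_of_abs_le {ι : Type*} {f : ι → ℝ} {B : ℝ} (hB : ∀ i, |f i| ≤ B) :
    BddAbove (Set.range f) :=
  ⟨B, by rintro _ ⟨i, rfl⟩; exact (abs_le.1 (hB i)).2⟩

theorem abs_ciSup_le {ι : Type*} [Nonempty ι] {f : ι → ℝ} {B : ℝ} (hB : ∀ i, |f i| ≤ B) :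
    |⨆ i, f i| ≤ B := by
  obtain ⟨i⟩ := ‹Nonempty ι›
  exact abs_le.2 ⟨(abs_le.1 (hB i)).1.trans (le_ciSup (bddAbove_range_of_abs_le hB) i),
    ciSup_le fun j => (abs_le.1 (hB j)).2⟩

end BoundedReal

section McDiarmid

variable {Z : Type*} [MeasurableSpace Z]

theorem measurePreserving_finCons (μ : Measure Z) [IsProbabilityMeasure μ] (n : ℕ) :
    MeasurePreserving (fun p : Z × (Fin n → Z) => (Fin.cons p.1 p.2 : Fin (n + 1) → Z))
      (μ.prod (Measure.pi fun _ : Fin n => μ)) (Measure.pi fun _ : Fin (n + 1) => μ) := by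
  have h := (measurePreserving_piFinSuccAbove (fun _ : Fin (n + 1) => μ) 0).symm
  convert h using 1
  ext p : 1
  simp [MeasurableEquiv.piFinSuccAbove]
  rfl

theorem integral_pi_finSucc (μ : Measure Z) [IsProbabilityMeasure μ] {n : ℕ}
    {f : (Fin (n + 1) → Z) → ℝ} (hf : Measurable f) {B : ℝ} (hB : ∀ S, |f S| ≤ B) :
    ∫ S, f S ∂(Measure.pi fun _ : Fin (n + 1) => μ) =
      ∫ z, ∫ S, f (Fin.cons z S) ∂(Measure.pi fun _ : Fin n => μ) ∂μ := by
  have hc := measurePreserving_finCons μ n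
  rw [← hc.map_eq, integral_map hc.measurable.aemeasurable hf.aestronglyMeasurable,
    integral_prod (fun p : Z × (Fin n → Z) => f (Fin.cons p.1 p.2))
      (integrable_of_abs_le (hf.comp hc.measurable) fun p => hB _)]

/-- **McDiarmid's inequality**, moment generating function form. -/
theorem hasSubgaussianMGF_of_bounded_differences (μ : Measure Z) [IsProbabilityMeasure μ]
    (c : NNReal) {B : ℝ} : ∀ {n : ℕ} {f : (Fin n → Z) → ℝ}, Measurable f → (∀ S, |f S| ≤ B) →
      (∀ S k z, f (Function.update S k z) ≤ f S + c) →
      HasSubgaussianMGF (fun S => f S - ∫ T, f T ∂(Measure.pi fun _ : Fin n => μ))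
        (n * (c / 2) ^ 2) (Measure.pi fun _ : Fin n => μ) := by
  have expBound : ∀ {n : ℕ} {f : (Fin n → Z) → ℝ}, (∀ S, |f S| ≤ B) → ∀ (a t : ℝ), |a| ≤ B →
      ∀ S, |Real.exp (t * (f S - a))| ≤ Real.exp (|t| * (B + B)) := by
    intro n f hB a t ha S
    rw [Real.abs_exp, Real.exp_le_exp]
    refine (le_abs_self _).trans ?_
    rw [abs_mul]
    gcongr
    exact (abs_sub _ _).trans (add_le_add (hB S) ha)
  intro n
  induction n with
  | zero =>
    intro f hf hB _
    have hconst : ∀ S, f S = f default := fun S => congrArg f (Subsingleton.elim _ _)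
    have h0 : (fun S => f S - ∫ T, f T ∂(Measure.pi fun _ : Fin 0 => μ)) = fun _ => 0 := by
      ext S
      simp_rw [hconst]
      simp
    rw [h0]
    simp
  | succ n ih =>
    intro f hf hB hd
    have hc := measurePreserving_finCons μ n
    set E := ∫ T, f T ∂(Measure.pi fun _ : Fin (n + 1) => μ)
    have hEB : |E| ≤ B := abs_integral_le_of_abs_le hB
    have hexpmeas : ∀ t, Measurable fun S => Real.exp (t * (f S - E)) := fun t => by fun_prop
    set g : Z → ℝ := fun z => ∫ S, f (Fin.cons z S) ∂(Measure.pi fun _ : Fin n => μ) with hg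
    have hfz : ∀ z, Measurable fun S : Fin n → Z => f (Fin.cons z S) := fun z =>
      (hf.comp hc.measurable).comp measurable_prodMk_left
    have hgB : ∀ z, |g z| ≤ B := fun z => abs_integral_le_of_abs_le fun S => hB _
    have hgm : Measurable g :=
      ((hf.comp hc.measurable).stronglyMeasurable.integral_prod_right').measurable
    have hEg : E = ∫ z, g z ∂μ := integral_pi_finSucc μ hf hB
    refine ⟨fun t => integrable_of_abs_le (hexpmeas t) (expBound hB E t hEB), fun t => ?_⟩
    have hgd : ∀ z w, g z ≤ g w + c := by
      intro z w
      have : g w + c = ∫ S, (f (Fin.cons w S) + c) ∂(Measure.pi fun _ : Fin n => μ) := by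
        rw [integral_add (integrable_of_abs_le (hfz w) fun S => hB _) (integrable_const _)]
        simp [hg]
      rw [this]
      refine integral_mono (integrable_of_abs_le (hfz z) fun S => hB _)
        ((integrable_of_abs_le (hfz w) fun S => hB _).add (integrable_const _)) fun S => ?_
      simpa using hd (Fin.cons w S) 0 z
    have hgbdd : BddBelow (Set.range g) := ⟨-B, by rintro _ ⟨z, rfl⟩; exact (abs_le.1 (hgB z)).1⟩
    have : Nonempty Z := nonempty_of_isProbabilityMeasure μ
    have hgIcc : ∀ z, g z ∈ Set.Icc (⨅ w, g w) ((⨅ w, g w) + c) := fun z =>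
      ⟨ciInf_le hgbdd z, by
        rw [← sub_le_iff_le_add]
        exact le_ciInf fun w => sub_le_iff_le_add.2 (hgd z w)⟩
    have hsg := (hasSubgaussianMGF_of_mem_Icc (μ := μ) hgm.aemeasurable
      (Filter.Eventually.of_forall hgIcc)).mgf_le t
    have hih : ∀ z, ∫ S, Real.exp (t * (f (Fin.cons z S) - g z)) ∂(Measure.pi fun _ : Fin n => μ) ≤
        Real.exp ((n * (c / 2) ^ 2 : NNReal) * t ^ 2 / 2) := fun z =>
      (ih (hfz z) (fun S => hB _) fun S k w => by
        rw [Fin.cons_update]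
        exact hd _ _ _).mgf_le t
    rw [mgf, integral_pi_finSucc μ (hexpmeas t) (expBound hB E t hEB)]
    have hsplit : ∀ z, ∫ S, Real.exp (t * (f (Fin.cons z S) - E)) ∂(Measure.pi fun _ : Fin n => μ) =
        (∫ S, Real.exp (t * (f (Fin.cons z S) - g z)) ∂(Measure.pi fun _ : Fin n => μ)) *
          Real.exp (t * (g z - E)) := by
      intro z
      rw [← integral_mul_const]
      congr 1 with S
      rw [← Real.exp_add]
      ring_nf
    calc ∫ z, ∫ S, Real.exp (t * (f (Fin.cons z S) - E)) ∂(Measure.pi fun _ : Fin n => μ) ∂μ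
        ≤ ∫ z, Real.exp ((n * (c / 2) ^ 2 : NNReal) * t ^ 2 / 2) * Real.exp (t * (g z - E)) ∂μ := by
          refine integral_mono ?_ ?_ fun z => ?_
          · exact integrable_of_abs_le
              (((hexpmeas t).comp hc.measurable).stronglyMeasurable.integral_prod_right').measurable
              fun z => abs_integral_le_of_abs_le fun S => expBound hB E t hEB _
          · refine Integrable.const_mul (integrable_of_abs_le (by fun_prop)
              (B := Real.exp (|t| * (B + B))) fun z => ?_) _
            exact expBound (n := 0) (f := fun _ => g z) (fun _ => hgB z) E t hEB default
          · simp only [hsplit]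
            gcongr
            exact hih z
      _ ≤ Real.exp ((n * (c / 2) ^ 2 : NNReal) * t ^ 2 / 2) *
            Real.exp (((c / 2) ^ 2 : NNReal) * t ^ 2 / 2) := by
          rw [integral_const_mul]
          gcongr
          simpa [mgf, ← hEg] using hsg
      _ = _ := by
          rw [← Real.exp_add]
          push_cast
          ring_nf

end McDiarmid

section Contraction

variable {ι : Type*} [Nonempty ι]

theorem ciSup_add_ciSup_sub_le {A a b : ι → ℝ} (hab : ∀ i j, |a i - a j| ≤ |b i - b j|)
    (hp : BddAbove (Set.range fun i => A i + b i)) (hm : BddAbove (Set.range fun i => A i - b i)) :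
    (⨆ i, (A i + a i)) + ⨆ i, (A i - a i) ≤ (⨆ i, (A i + b i)) + ⨆ i, (A i - b i) := by
  refine ciSup_add_ciSup_le fun i j => ?_
  have h1 := le_ciSup hp i
  have h2 := le_ciSup hm j
  have h3 := le_ciSup hp j
  have h4 := le_ciSup hm i
  have h5 := (le_abs_self _).trans (hab i j)
  rcases abs_cases (b i - b j) with ⟨h, _⟩ | ⟨h, _⟩ <;> linarith

theorem sum_sign_finSucc {n : ℕ} (F : (Fin (n + 1) → Bool) → ℝ) :
    ∑ σ, F σ = ∑ σ : Fin n → Bool, (F (Fin.cons true σ) + F (Fin.cons false σ)) := by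
  rw [← (Fin.consEquiv fun _ => Bool).sum_comp, Fintype.sum_prod_type, Fintype.sum_bool,
    Finset.sum_add_distrib]
  rfl

/-- **Talagrand's contraction principle** for Rademacher sums. -/
theorem sum_ciSup_contraction : ∀ {n : ℕ} (A : ι → ℝ) (a b : Fin n → ι → ℝ) {B : ℝ},
    (∀ i, |A i| ≤ B) → (∀ k i, |a k i| ≤ B) → (∀ k i, |b k i| ≤ B) →
    (∀ k i j, |a k i - a k j| ≤ |b k i - b k j|) →
    ∑ σ : Fin n → Bool, ⨆ i, (A i + ∑ k, (if σ k then (1 : ℝ) else -1) * a k i) ≤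
      ∑ σ : Fin n → Bool, ⨆ i, (A i + ∑ k, (if σ k then (1 : ℝ) else -1) * b k i) := by
  intro n
  induction n with
  | zero => intros; simp
  | succ n ih =>
    intro A a b B hA ha hb hab
    have hB : 0 ≤ B := (abs_nonneg _).trans (hA (Classical.arbitrary ι))
    have hadd : ∀ i, |A i + a 0 i| ≤ B + B := fun i =>
      (abs_add_le _ _).trans (add_le_add (hA i) (ha 0 i))
    have hsub : ∀ i, |A i - a 0 i| ≤ B + B := fun i =>
      (abs_sub _ _).trans (add_le_add (hA i) (ha 0 i))
    have hBB : B ≤ B + B := by linarith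
    have key := fun (A' : ι → ℝ) (h : ∀ i, |A' i| ≤ B + B) =>
      ih A' (fun k => a k.succ) (fun k => b k.succ) h (fun k i => (ha _ i).trans hBB)
        (fun k i => (hb _ i).trans hBB) fun k => hab k.succ
    have h1 := key _ hadd
    have h2 := key _ hsub
    have hsum : ∀ (σ : Fin n → Bool) i,
        |∑ k, (if σ k then (1 : ℝ) else -1) * b k.succ i| ≤ n * B := by
      intro σ i
      refine (Finset.abs_sum_le_sum_abs _ _).trans ?_
      calc _ ≤ ∑ _k : Fin n, B := Finset.sum_le_sum fun k _ => by
              split_ifs <;> simpa using hb k.succ i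
        _ = n * B := by simp
    simp only [sum_sign_finSucc, Fin.sum_univ_succ, Fin.cons_zero, Fin.cons_succ, if_true,
      Bool.false_eq_true, if_false, one_mul, neg_mul, ← add_assoc, ← sub_eq_add_neg]
    rw [Finset.sum_add_distrib]
    refine (add_le_add h1 h2).trans ?_
    rw [← Finset.sum_add_distrib]
    refine Finset.sum_le_sum fun σ _ => ?_
    have hbound : ∀ i, |A i + (∑ k, (if σ k then (1 : ℝ) else -1) * b k.succ i)| ≤ B + n * B :=
      fun i => (abs_add_le _ _).trans (add_le_add (hA i) (hsum σ i))
    have h := ciSup_add_ciSup_sub_le (A := fun i => A i +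
        (∑ k, (if σ k then (1 : ℝ) else -1) * b k.succ i)) (hab 0)
      (bddAbove_range_of_abs_le (B := B + n * B + B) fun i =>
        (abs_add_le _ _).trans (add_le_add (hbound i) (hb 0 i)))
      (bddAbove_range_of_abs_le (B := B + n * B + B) fun i =>
        (abs_sub _ _).trans (add_le_add (hbound i) (hb 0 i)))
    simpa only [add_right_comm, add_sub_right_comm] using h

end Contraction

section Symmetrization

variable {ι Z : Type*}

/-- The supremum over the class `g` of the Rademacher averages with signs `σ` on the sample `s`. -/
noncomputable def supSignedMean (g : ι → Z → ℝ) {m : ℕ} (σ : Fin m → Bool) (s : Fin m → Z) : ℝ :=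
  ⨆ i, (m : ℝ)⁻¹ * ∑ k, (if σ k then (1 : ℝ) else -1) * g i (s k)

theorem abs_mean_le {m : ℕ} {B : ℝ} (hB : 0 ≤ B) {v : Fin m → ℝ} (hv : ∀ k, |v k| ≤ B) :
    |(m : ℝ)⁻¹ * ∑ k, v k| ≤ B := by
  rcases Nat.eq_zero_or_pos m with rfl | hm
  · simpa using hB
  rw [abs_mul, abs_of_nonneg (by positivity), inv_mul_le_iff₀ (by positivity)]
  refine (Finset.abs_sum_le_sum_abs _ _).trans ((Finset.sum_le_sum fun k _ => hv k).trans ?_)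
  simp

theorem abs_sign_mul (b : Bool) (x : ℝ) : |(if b then (1 : ℝ) else -1) * x| = |x| := by
  cases b <;> simp

theorem abs_supSignedMean_le [Nonempty ι] {g : ι → Z → ℝ} {B : ℝ} (hB : 0 ≤ B)
    (hg : ∀ i z, |g i z| ≤ B) {m : ℕ} (σ : Fin m → Bool) (s : Fin m → Z) :
    |supSignedMean g σ s| ≤ B :=
  abs_ciSup_le fun i => abs_mean_le hB fun k => by rw [abs_sign_mul]; exact hg i _

variable [MeasurableSpace Z]

theorem measurable_supSignedMean [Countable ι] {g : ι → Z → ℝ} (hg : ∀ i, Measurable (g i)) {m : ℕ}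
    (σ : Fin m → Bool) : Measurable (supSignedMean g σ : (Fin m → Z) → ℝ) :=
  Measurable.iSup fun i => Measurable.const_mul (Finset.measurable_sum _ fun k _ =>
    ((hg i).comp (measurable_pi_apply k)).const_mul _) _

theorem measurePreserving_coordinateSwap (μ : Measure Z) [IsProbabilityMeasure μ] {m : ℕ}
    (σ : Fin m → Bool) :
    MeasurePreserving (fun p : (Fin m → Z) × (Fin m → Z) =>
        ((fun k => if σ k then p.1 k else p.2 k, fun k => if σ k then p.2 k else p.1 k) :
          (Fin m → Z) × (Fin m → Z)))
      ((Measure.pi fun _ : Fin m => μ).prod (Measure.pi fun _ : Fin m => μ))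
      ((Measure.pi fun _ : Fin m => μ).prod (Measure.pi fun _ : Fin m => μ)) := by
  have he := measurePreserving_arrowProdEquivProdArrow Z Z (Fin m) (fun _ => μ) (fun _ => μ)
  have hs : MeasurePreserving
      (fun (T : Fin m → Z × Z) k => (if σ k then id else Prod.swap) (T k))
      (Measure.pi fun _ : Fin m => μ.prod μ) (Measure.pi fun _ : Fin m => μ.prod μ) :=
    measurePreserving_pi _ _ fun k => by
      split_ifs
      exacts [MeasurePreserving.id _, Measure.measurePreserving_swap]
  convert he.comp (hs.comp he.symm) using 1
  ext p k <;> by_cases h : σ k <;>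
    simp [MeasurableEquiv.arrowProdEquivProdArrow, Equiv.arrowProdEquivProdArrow, h]

/-- **Symmetrization**: the expected uniform deviation between true and empirical means is at most
twice the Rademacher complexity. -/
theorem integral_ciSup_deviation_le [Nonempty ι] [Countable ι] (μ : Measure Z)
    [IsProbabilityMeasure μ] {g : ι → Z → ℝ}
    (hg : ∀ i, Measurable (g i)) {B : ℝ} (hB : ∀ i z, |g i z| ≤ B)
    {m : ℕ} (hm : 1 ≤ m) :
    ∫ S, ⨆ i, (∫ z, g i z ∂μ - (m : ℝ)⁻¹ * ∑ k, g i (S k)) ∂(Measure.pi fun _ : Fin m => μ) ≤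
      2 * ∫ S, ((2 : ℝ) ^ m)⁻¹ * ∑ σ, supSignedMean g σ S ∂(Measure.pi fun _ : Fin m => μ) := by
  set ν := Measure.pi fun _ : Fin m => μ with hν
  have : Nonempty Z := nonempty_of_isProbabilityMeasure μ
  have hB0 : 0 ≤ B := (abs_nonneg _).trans (hB (Classical.arbitrary ι) (Classical.arbitrary Z))
  have hm0 : (m : ℝ) ≠ 0 := by positivity
  have hint : ∀ σ, Integrable (supSignedMean g σ) ν := fun σ =>
    integrable_of_abs_le (measurable_supSignedMean hg σ) fun S => abs_supSignedMean_le hB0 hB σ S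
  set D : (Fin m → Bool) → (Fin m → Z) × (Fin m → Z) → ℝ := fun σ p =>
    ⨆ i, (m : ℝ)⁻¹ * ∑ k, (if σ k then (1 : ℝ) else -1) * (g i (p.2 k) - g i (p.1 k))
  have hDterm : ∀ (σ : Fin m → Bool) (p : (Fin m → Z) × (Fin m → Z)) (i : ι),
      |(m : ℝ)⁻¹ * ∑ k, (if σ k then (1 : ℝ) else -1) * (g i (p.2 k) - g i (p.1 k))| ≤ B + B :=
    fun σ p i => abs_mean_le (by positivity) fun k => by
      rw [abs_sign_mul]
      exact (abs_sub _ _).trans (add_le_add (hB _ _) (hB _ _))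
  have hDB : ∀ σ p, |D σ p| ≤ B + B := fun σ p => abs_ciSup_le (hDterm σ p)
  have hDm : ∀ σ, Measurable (D σ) := fun σ => Measurable.iSup fun i => by
    refine Measurable.const_mul (Finset.measurable_sum _ fun k _ => Measurable.const_mul ?_ _) _
    exact ((hg i).comp ((measurable_pi_apply k).comp measurable_snd)).sub
      ((hg i).comp ((measurable_pi_apply k).comp measurable_fst))
  have hDi : ∀ σ, Integrable (D σ) (ν.prod ν) := fun σ => integrable_of_abs_le (hDm σ) (hDB σ)
  have hghost : ∫ S, ⨆ i, (∫ z, g i z ∂μ - (m : ℝ)⁻¹ * ∑ k, g i (S k)) ∂ν ≤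
      ∫ p, D (fun _ => true) p ∂(ν.prod ν) := by
    rw [integral_prod _ (hDi _)]
    have hdev : ∀ S : Fin m → Z, ∀ i, |∫ z, g i z ∂μ - (m : ℝ)⁻¹ * ∑ k, g i (S k)| ≤ B + B :=
      fun S i => (abs_sub _ _).trans
        (add_le_add (abs_integral_le_of_abs_le (hB i)) (abs_mean_le hB0 fun k => hB i _))
    refine integral_mono (integrable_of_abs_le (Measurable.iSup fun i => ?_)
      fun S => abs_ciSup_le (hdev S)) (hDi _).integral_prod_left fun S => ?_
    · exact measurable_const.sub (Measurable.const_mul (Finset.measurable_sum _ fun k _ =>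
        (hg i).comp (measurable_pi_apply k)) _)
    refine ciSup_le fun i => ?_
    have hev : ∀ k, Integrable (fun T : Fin m → Z => g i (T k)) ν := fun k =>
      integrable_of_abs_le ((hg i).comp (measurable_pi_apply k)) fun T => hB i _
    have hmean : ∫ z, g i z ∂μ - (m : ℝ)⁻¹ * ∑ k, g i (S k) =
        ∫ T, (m : ℝ)⁻¹ * ∑ k, (if true then (1 : ℝ) else -1) * (g i (T k) - g i (S k)) ∂ν := by
      simp only [if_true, one_mul]
      rw [integral_const_mul,
        integral_finsetSum (f := fun k (T : Fin m → Z) => g i (T k) - g i (S k)) _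
          fun k _ => (hev k).sub (integrable_const _)]
      have : ∀ k, ∫ T, (g i (T k) - g i (S k)) ∂ν = ∫ z, g i z ∂μ - g i (S k) := fun k => by
        rw [integral_sub (hev k) (integrable_const _), hν,
          integral_comp_eval (μ := fun _ : Fin m => μ) (hg i).aestronglyMeasurable]
        simp
      simp only [this, Finset.sum_sub_distrib, Finset.sum_const, Finset.card_univ, Fintype.card_fin,
        nsmul_eq_mul]
      field_simp
    rw [hmean]
    refine integral_mono (integrable_of_abs_le ?_ fun T => hDterm (fun _ => true) (S, T) i)
      (integrable_of_abs_le ((hDm _).comp measurable_prodMk_left) fun T => hDB _ _)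
      fun T => le_ciSup (bddAbove_range_of_abs_le (hDterm (fun _ => true) (S, T))) i
    exact Measurable.const_mul (Finset.measurable_sum _ fun k _ => Measurable.const_mul
      (((hg i).comp (measurable_pi_apply k)).sub measurable_const) _) _
  have hswap : ∀ σ, ∫ p, D (fun _ => true) p ∂(ν.prod ν) = ∫ p, D σ p ∂(ν.prod ν) := by
    intro σ
    have hp := measurePreserving_coordinateSwap μ σ
    conv_lhs => rw [← hp.map_eq]
    rw [integral_map hp.measurable.aemeasurable (hDm _).aestronglyMeasurable]
    refine integral_congr_ae (Filter.Eventually.of_forall fun p => ?_)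
    refine iSup_congr fun i => ?_
    congr 1
    refine Finset.sum_congr rfl fun k _ => ?_
    by_cases h : σ k <;> simp [h]
  have hsplit : ∀ σ, ∫ p, D σ p ∂(ν.prod ν) ≤
      ∫ S, supSignedMean g σ S ∂ν + ∫ S, supSignedMean g (fun k => !σ k) S ∂ν := by
    intro σ
    have h2 := (hint σ).comp_snd ν
    have h1 := (hint fun k => !σ k).comp_fst ν
    have e2 : ∫ p : (Fin m → Z) × (Fin m → Z), supSignedMean g σ p.2 ∂(ν.prod ν) =
        ∫ S, supSignedMean g σ S ∂ν := by simp [integral_fun_snd]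
    have e1 : ∫ p : (Fin m → Z) × (Fin m → Z), supSignedMean g (fun k => !σ k) p.1 ∂(ν.prod ν) =
        ∫ S, supSignedMean g (fun k => !σ k) S ∂ν := by
      rw [integral_fun_fst (fun S => supSignedMean g (fun k => !σ k) S)]; simp
    rw [← e1, ← e2, ← integral_add h2 h1]
    refine integral_mono (hDi σ) (h2.add h1) fun p => ciSup_le fun i => ?_
    have hle : ∀ (τ : Fin m → Bool) (s : Fin m → Z),
        (m : ℝ)⁻¹ * ∑ k, (if τ k then (1 : ℝ) else -1) * g i (s k) ≤ supSignedMean g τ s :=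
      fun τ s => le_ciSup (f := fun i => (m : ℝ)⁻¹ * ∑ k, (if τ k then (1 : ℝ) else -1) * g i (s k))
        (bddAbove_range_of_abs_le fun i => abs_mean_le hB0 fun k => by
          rw [abs_sign_mul]; exact hB i _) i
    refine le_trans (le_of_eq ?_) (add_le_add (hle σ p.2) (hle (fun k => !σ k) p.1))
    rw [← mul_add, ← Finset.sum_add_distrib]
    congr 1
    refine Finset.sum_congr rfl fun k _ => ?_
    cases σ k <;> simp <;> ring
  have hflip : ∑ σ : Fin m → Bool, ∫ S, supSignedMean g (fun k => !σ k) S ∂ν =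
      ∑ σ : Fin m → Bool, ∫ S, supSignedMean g σ S ∂ν :=
    (Equiv.piCongrRight fun _ : Fin m => Equiv.boolNot).sum_comp
      fun σ => ∫ S, supSignedMean g σ S ∂ν
  have hsum : (2 : ℝ) ^ m * ∫ p, D (fun _ => true) p ∂(ν.prod ν) ≤
      2 * ∑ σ : Fin m → Bool, ∫ S, supSignedMean g σ S ∂ν := by
    calc (2 : ℝ) ^ m * ∫ p, D (fun _ => true) p ∂(ν.prod ν)
        = ∑ σ : Fin m → Bool, ∫ p, D σ p ∂(ν.prod ν) := by simp [← hswap]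
      _ ≤ _ := Finset.sum_le_sum fun σ _ => hsplit σ
      _ = _ := by rw [Finset.sum_add_distrib, hflip, two_mul]
  rw [integral_const_mul, integral_finsetSum _ fun σ _ => hint σ]
  refine hghost.trans ?_
  rw [mul_left_comm, le_inv_mul_iff₀ (by positivity)]
  exact hsum

end Symmetrization

/-- **Uniform one-sided deviation bound** for a countable class of `[0,1]`-valued functions. -/
theorem measureReal_ciSup_deviation_ge_le {ι Z : Type*} [Nonempty ι] [Countable ι]
    [MeasurableSpace Z] (μ : Measure Z) [IsProbabilityMeasure μ] {g : ι → Z → ℝ}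
    (hg : ∀ i, Measurable (g i)) (h01 : ∀ i z, g i z ∈ Set.Icc (0 : ℝ) 1) {m : ℕ} (hm : 1 ≤ m)
    {ε : ℝ} (hε : 0 ≤ ε) :
    (Measure.pi fun _ : Fin m => μ).real {S | ε ≤
      (⨆ i, (∫ z, g i z ∂μ - (m : ℝ)⁻¹ * ∑ k, g i (S k))) -
        ∫ T, ⨆ i, (∫ z, g i z ∂μ - (m : ℝ)⁻¹ * ∑ k, g i (T k)) ∂(Measure.pi fun _ : Fin m => μ)} ≤
      Real.exp (-(2 * m * ε ^ 2)) := by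
  have hB : ∀ i z, |g i z| ≤ 1 := fun i z => abs_le.2 ⟨by linarith [(h01 i z).1], (h01 i z).2⟩
  have hm0 : (m : ℝ) ≠ 0 := by positivity
  have hdev : ∀ S : Fin m → Z, ∀ i, |∫ z, g i z ∂μ - (m : ℝ)⁻¹ * ∑ k, g i (S k)| ≤ 1 + 1 :=
    fun S i => (abs_sub _ _).trans
      (add_le_add (abs_integral_le_of_abs_le (hB i)) (abs_mean_le zero_le_one fun k => hB i _))
  have hsg := hasSubgaussianMGF_of_bounded_differences μ (m : NNReal)⁻¹ (n := m)
    (f := fun S => ⨆ i, (∫ z, g i z ∂μ - (m : ℝ)⁻¹ * ∑ k, g i (S k)))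
    (Measurable.iSup fun i => measurable_const.sub (Measurable.const_mul
      (Finset.measurable_sum _ fun k _ => (hg i).comp (measurable_pi_apply k)) _))
    (fun S => abs_ciSup_le (hdev S)) fun S k z => ciSup_le fun i => by
      have h := le_ciSup (bddAbove_range_of_abs_le (hdev S)) i
      have hs : ∑ j, g i (S j) ≤ ∑ j, g i (Function.update S k z j) + 1 := by
        rw [← Finset.add_sum_erase _ _ (Finset.mem_univ k),
          ← Finset.add_sum_erase _ (fun j => g i (Function.update S k z j)) (Finset.mem_univ k),
          Finset.sum_congr rfl (f := fun j => g i (Function.update S k z j))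
            (g := fun j => g i (S j)) fun j hj => by
              rw [Function.update_of_ne (Finset.ne_of_mem_erase hj)], Function.update_self]
        linarith [(h01 i (S k)).2, (h01 i z).1]
      have hs' := mul_le_mul_of_nonneg_left hs (inv_nonneg.2 (Nat.cast_nonneg (α := ℝ) m))
      push_cast
      linarith
  refine (hsg.measure_ge_le hε).trans_eq ?_
  congr 1
  push_cast
  field_simp

theorem statement0 {X : Type*} [MeasurableSpace X]
    (P : Measure (X × ({-1, 1} : Set ℝ))) [IsProbabilityMeasure P]
    (H : Set (X → ℝ)) (hHne : H.Nonempty) (hHcnt : H.Countable)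
    (hHmeas : ∀ h ∈ H, Measurable h)
    (C : ℝ) (hHbdd : ∀ h ∈ H, ∀ x, |h x| ≤ C)
    (ζ : ℝ) (hζ : 0 < ζ) (δ : ℝ) (hδ : δ ∈ Set.Ioo (0 : ℝ) 1)
    (m : ℕ) (hm : 1 ≤ m) :
    ENNReal.ofReal (1 - δ) ≤
      (Measure.pi fun _ : Fin m => P)
        {S : Fin m → X × ({-1, 1} : Set ℝ) |
          ∀ h ∈ H,
            (P {p : X × ({-1, 1} : Set ℝ) | (p.2 : ℝ) * h p.1 ≤ ζ}).toReal ≤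
              ((m : ℝ))⁻¹ * ∑ i, phi 2 ζ (((S i).2 : ℝ) * h (S i).1)
                + (2 / ζ) *
                    ∫ s, empRad H m s ∂(Measure.pi fun _ : Fin m => P.map Prod.fst)
                + Real.sqrt (Real.log (1 / δ) / (2 * m))} := by
  have : Nonempty H := hHne.to_subtype
  have : Countable H := hHcnt.to_subtype
  have hmpos : (0 : ℝ) < m := by positivity
  have hfst : Measurable (Prod.fst : X × ({-1, 1} : Set ℝ) → X) := measurable_fst
  have : IsProbabilityMeasure (P.map Prod.fst) := Measure.isProbabilityMeasure_map hfst.aemeasurable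
  obtain ⟨x₀⟩ : Nonempty X := nonempty_of_isProbabilityMeasure (P.map Prod.fst)
  have hC : 0 ≤ C := (abs_nonneg _).trans (hHbdd _ hHne.some_mem x₀)
  set ν := Measure.pi fun _ : Fin m => P
  set g : H → X × ({-1, 1} : Set ℝ) → ℝ :=
    fun h p => min 1 (phi 2 ζ ((p.2 : ℝ) * h.1 p.1))
  have hzm : ∀ h : H, Measurable fun p : X × ({-1, 1} : Set ℝ) => (p.2 : ℝ) * h.1 p.1 := fun h =>
    (measurable_subtype_coe.comp measurable_snd).mul ((hHmeas h.1 h.2).comp measurable_fst)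
  have hgm : ∀ h, Measurable (g h) := fun h =>
    measurable_const.min (measurable_const.max (measurable_const.sub ((hzm h).div_const ζ)))
  have h01 : ∀ h p, g h p ∈ Set.Icc (0 : ℝ) 1 := fun h p =>
    ⟨le_min zero_le_one (le_max_left _ _), min_le_left _ _⟩
  have hgB : ∀ h p, |g h p| ≤ 1 := fun h p =>
    abs_le.2 ⟨by linarith [(h01 h p).1], (h01 h p).2⟩
  have hrisk : ∀ h : H, (P {p : X × ({-1, 1} : Set ℝ) | (p.2 : ℝ) * h.1 p.1 ≤ ζ}).toReal ≤
      ∫ p, g h p ∂P := by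
    intro h
    have hms : MeasurableSet {p : X × ({-1, 1} : Set ℝ) | (p.2 : ℝ) * h.1 p.1 ≤ ζ} :=
      measurableSet_le (hzm h) measurable_const
    change P.real _ ≤ _
    rw [← integral_indicator_one hms]
    refine integral_mono ((integrable_const (1 : ℝ)).indicator hms)
      (integrable_of_abs_le (hgm h) (hgB h)) fun p => ?_
    by_cases hp : (p.2 : ℝ) * h.1 p.1 ≤ ζ
    · rw [Set.indicator_of_mem (by exact hp)]
      refine le_min le_rfl (le_max_of_le_right ?_)
      have := (div_le_one hζ).2 hp
      simp only [Pi.one_apply]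
      linarith
    · rw [Set.indicator_of_notMem (by exact hp)]
      exact (h01 h p).1
  have hlip : ∀ (h h' : H) p, |g h p - g h' p| ≤ |ζ⁻¹ * h.1 p.1 - ζ⁻¹ * h'.1 p.1| := by
    rintro h h' ⟨x, y, hy⟩
    refine (abs_min_sub_min_le_max _ _ _ _).trans ?_
    simp only [sub_self, abs_zero]
    refine max_le (abs_nonneg _) ((abs_max_sub_max_le_max _ _ _ _).trans ?_)
    simp only [sub_self, abs_zero]
    refine max_le (abs_nonneg _) (le_of_eq ?_)
    rcases hy with rfl | rfl
    · congr 1; ring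
    · rw [← abs_neg]; congr 1; ring
  have hcontr : ∀ S : Fin m → X × ({-1, 1} : Set ℝ),
      ((2 : ℝ) ^ m)⁻¹ * ∑ σ, supSignedMean g σ S ≤ ζ⁻¹ * empRad H m fun k => (S k).1 := by
    intro S
    have hminv : (m : ℝ)⁻¹ ≤ 1 := inv_le_one_of_one_le₀ (by exact_mod_cast hm)
    have h := sum_ciSup_contraction (fun _ : H => (0 : ℝ)) (fun k h => (m : ℝ)⁻¹ * g h (S k))
      (fun k h => (m : ℝ)⁻¹ * (ζ⁻¹ * h.1 (S k).1)) (B := 1 + ζ⁻¹ * C)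
      (fun _ => by rw [abs_zero]; positivity)
      (fun k h => by
        rw [abs_mul, abs_of_pos (inv_pos.2 hmpos)]
        have := mul_le_mul hminv (hgB h (S k)) (abs_nonneg _) zero_le_one
        have : 0 ≤ ζ⁻¹ * C := by positivity
        linarith)
      (fun k h => by
        rw [abs_mul, abs_mul, abs_of_pos (inv_pos.2 hmpos), abs_of_pos (inv_pos.2 hζ)]
        have h1 : ζ⁻¹ * |h.1 (S k).1| ≤ ζ⁻¹ * C := by gcongr; exact hHbdd _ h.2 _
        have := mul_le_mul hminv h1 (by positivity) zero_le_one
        linarith)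
      (fun k h h' => by
        rw [← mul_sub, ← mul_sub, abs_mul, abs_mul]
        exact mul_le_mul_of_nonneg_left (hlip h h' (S k)) (abs_nonneg _))
    simp only [zero_add] at h
    rw [empRad, mul_left_comm, Finset.mul_sum _ _ ζ⁻¹]
    refine mul_le_mul_of_nonneg_left ?_ (by positivity)
    refine Eq.trans_le ?_ (h.trans_eq ?_)
    · refine Finset.sum_congr rfl fun σ _ => iSup_congr fun i => ?_
      rw [Finset.mul_sum]
      exact Finset.sum_congr rfl fun k _ => by ring
    · refine Finset.sum_congr rfl fun σ _ => ?_
      rw [Real.mul_iSup_of_nonneg (by positivity)]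
      refine iSup_congr fun i => ?_
      rw [Finset.mul_sum, Finset.mul_sum]
      exact Finset.sum_congr rfl fun k _ => by ring
  have hradm : Measurable (empRad H m) :=
    Measurable.const_mul (Finset.measurable_sum _ fun σ _ =>
      measurable_supSignedMean (g := fun h : H => h.1) (fun h => hHmeas h.1 h.2) σ) _
  have hradB : ∀ s, |empRad H m s| ≤ C := by
    intro s
    rw [empRad, abs_mul, abs_of_pos (by positivity), inv_mul_le_iff₀ (by positivity)]
    refine (Finset.abs_sum_le_sum_abs _ _).trans ((Finset.sum_le_sum fun σ _ =>
      abs_supSignedMean_le (g := fun h : H => h.1) hC (fun h => hHbdd h.1 h.2) σ s).trans ?_)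
    simp
  have hproj : MeasurePreserving (fun (S : Fin m → X × ({-1, 1} : Set ℝ)) k => (S k).1)
      ν (Measure.pi fun _ : Fin m => P.map Prod.fst) :=
    measurePreserving_pi _ _ fun _ => hfst.measurePreserving P
  have hexp : ∫ S, ⨆ h, (∫ p, g h p ∂P - (m : ℝ)⁻¹ * ∑ k, g h (S k)) ∂ν ≤
      (2 / ζ) * ∫ s, empRad H m s ∂(Measure.pi fun _ : Fin m => P.map Prod.fst) := by
    refine (integral_ciSup_deviation_le P hgm hgB hm).trans ?_
    rw [← hproj.map_eq, integral_map hproj.measurable.aemeasurable hradm.aestronglyMeasurable,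
      div_eq_mul_inv, mul_assoc, ← integral_const_mul ζ⁻¹]
    refine mul_le_mul_of_nonneg_left (integral_mono (Integrable.const_mul (integrable_finsetSum _
      fun σ _ => integrable_of_abs_le (measurable_supSignedMean hgm σ)
        (abs_supSignedMean_le zero_le_one hgB σ)) _) ?_ hcontr) zero_le_two
    exact (integrable_of_abs_le (hradm.comp hproj.measurable) fun S => hradB _).const_mul _
  set ε := Real.sqrt (Real.log (1 / δ) / (2 * m)) with hεdef
  have hlog : 0 ≤ Real.log (1 / δ) := Real.log_nonneg (by rw [le_div_iff₀ hδ.1]; linarith [hδ.2])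
  have htail := measureReal_ciSup_deviation_ge_le P hgm h01 hm (Real.sqrt_nonneg _ : 0 ≤ ε)
  have hexpδ : Real.exp (-(2 * m * ε ^ 2)) = δ := by
    rw [hεdef, Real.sq_sqrt (by positivity), mul_div_cancel₀ _ (by positivity), one_div,
      Real.log_inv, neg_neg, Real.exp_log hδ.1]
  rw [hexpδ] at htail
  set bad := {S : Fin m → X × ({-1, 1} : Set ℝ) | ε ≤
      (⨆ h, (∫ p, g h p ∂P - (m : ℝ)⁻¹ * ∑ k, g h (S k))) -
        ∫ T, ⨆ h, (∫ p, g h p ∂P - (m : ℝ)⁻¹ * ∑ k, g h (T k)) ∂ν}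
  have hbadm : MeasurableSet bad :=
    measurableSet_le measurable_const (Measurable.sub_const (Measurable.iSup fun h =>
      measurable_const.sub (Measurable.const_mul (Finset.measurable_sum _ fun k _ =>
        (hgm h).comp (measurable_pi_apply k)) _)) _)
  have hgood : 1 - δ ≤ ν.real badᶜ := by
    rw [probReal_compl_eq_one_sub hbadm]
    linarith
  refine (ENNReal.ofReal_le_of_le_toReal hgood).trans (measure_mono fun S hS h hh => ?_)
  have hS' : (⨆ h, (∫ p, g h p ∂P - (m : ℝ)⁻¹ * ∑ k, g h (S k))) -
        ∫ T, ⨆ h, (∫ p, g h p ∂P - (m : ℝ)⁻¹ * ∑ k, g h (T k)) ∂ν < ε := not_le.1 hS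
  have hsup := le_ciSup (f := fun h => ∫ p, g h p ∂P - (m : ℝ)⁻¹ * ∑ k, g h (S k))
    (bddAbove_range_of_abs_le (B := 1 + 1) fun h => (abs_sub _ _).trans
      (add_le_add (abs_integral_le_of_abs_le (hgB h)) (abs_mean_le zero_le_one fun k => hgB h _)))
    ⟨h, hh⟩
  have hphi : (m : ℝ)⁻¹ * ∑ k, g ⟨h, hh⟩ (S k) ≤
      (m : ℝ)⁻¹ * ∑ k, phi 2 ζ (((S k).2 : ℝ) * h (S k).1) := by
    gcongr with k
    exact min_le_right _ _
  have := hrisk ⟨h, hh⟩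
  simp only at this hsup
  linarith
end

section
/- Let 𝓗 be a real Hilbert space, ψ : X → 𝓗 a feature map, and u, v ≥ 0. Let x_1,…,x_m ∈ X satisfy K(x_i,x_i) = ⟨ψ(x_i), ψ(x_i)⟩ ≤ u² for all i. Let H = { x ↦ ⟨w, ψ(x)⟩ : w ∈ 𝓗, ‖w‖ ≤ v }. Then the empirical Rademacher complexity of H with respect to the sample x_1,…,x_m satisfies R̂_S(H) ≤ √(u²v²/m). -/
open scoped RealInnerProductSpace

lemma sum_sign_mul_sign {m : ℕ} (i j : Fin m) :
    ∑ σ : Fin m → Bool, (if σ i then (1 : ℝ) else -1) * (if σ j then (1 : ℝ) else -1) =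
      if i = j then (2 : ℝ) ^ m else 0 := by
  split_ifs with h
  · subst h
    have h1 (σ : Fin m → Bool) :
        (if σ i then (1 : ℝ) else -1) * (if σ i then (1 : ℝ) else -1) = 1 := by
      split_ifs <;> norm_num
    simp [h1]
  · refine Finset.sum_involution (fun σ _ => Function.update σ i (!σ i)) ?_ ?_ ?_ ?_
    · intro σ _
      rw [Function.update_self, Function.update_of_ne (Ne.symm h)]
      cases σ i <;> cases σ j <;> simp
    · intro σ _ _ heq
      have := congrFun heq i
      simp at this
    · simp
    · intro σ _
      simp

lemma sum_norm_sq_signed_sum {E : Type*} [NormedAddCommGroup E] [InnerProductSpace ℝ E]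
    {m : ℕ} (a : Fin m → E) :
    ∑ σ : Fin m → Bool, ‖∑ i, (if σ i then (1 : ℝ) else -1) • a i‖ ^ 2 =
      (2 : ℝ) ^ m * ∑ i, ⟪a i, a i⟫ := by
  have expand (σ : Fin m → Bool) : ‖∑ i, (if σ i then (1 : ℝ) else -1) • a i‖ ^ 2 =
      ∑ i, ∑ j, (if σ i then (1 : ℝ) else -1) * (if σ j then (1 : ℝ) else -1) *
        ⟪a i, a j⟫ := by
    simp only [← real_inner_self_eq_norm_sq, sum_inner, inner_sum, real_inner_smul_left,
      real_inner_smul_right, mul_assoc]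
    simp only [real_inner_comm]
  simp only [expand]
  rw [Finset.sum_comm, Finset.mul_sum]
  refine Finset.sum_congr rfl fun i _ => ?_
  rw [Finset.sum_comm]
  simp only [← Finset.sum_mul, sum_sign_mul_sign]
  simp

/-- Bound on the mean norm of a Rademacher sum of vectors. -/
lemma mean_norm_signed_sum_le {E : Type*} [NormedAddCommGroup E] [InnerProductSpace ℝ E]
    {m : ℕ} (a : Fin m → E) :
    ((2 : ℝ) ^ m)⁻¹ * ∑ σ : Fin m → Bool, ‖∑ i, (if σ i then (1 : ℝ) else -1) • a i‖ ≤
      √(∑ i, ⟪a i, a i⟫) := by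
  apply Real.le_sqrt_of_sq_le
  have h := sq_sum_le_card_mul_sum_sq (s := (Finset.univ : Finset (Fin m → Bool)))
    (f := fun σ => ‖∑ i, (if σ i then (1 : ℝ) else -1) • a i‖)
  rw [sum_norm_sq_signed_sum] at h
  simp only [Finset.card_univ, Fintype.card_fun, Fintype.card_bool, Fintype.card_fin,
    Nat.cast_pow, Nat.cast_ofNat] at h
  rw [mul_pow, inv_pow, inv_mul_le_iff₀ (by positivity)]
  linarith

theorem statement4 {𝓗 X : Type*} [NormedAddCommGroup 𝓗] [InnerProductSpace ℝ 𝓗]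
    [CompleteSpace 𝓗]
    (ψ : X → 𝓗) (u v : ℝ) (hu : 0 ≤ u) (hv : 0 ≤ v)
    (m : ℕ) (x : Fin m → X) (hx : ∀ i, ⟪ψ (x i), ψ (x i)⟫ ≤ u ^ 2) :
    empRad {f : X → ℝ | ∃ w : 𝓗, ‖w‖ ≤ v ∧ f = fun p => ⟪w, ψ p⟫} m x ≤
      Real.sqrt (u ^ 2 * v ^ 2 / m) := by
  set Z : (Fin m → Bool) → 𝓗 :=
    fun σ => ∑ i, (if σ i then (1 : ℝ) else -1) • ψ (x i) with hZ
  have hsup (σ : Fin m → Bool) :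
      (⨆ h : {f : X → ℝ | ∃ w : 𝓗, ‖w‖ ≤ v ∧ f = fun p => ⟪w, ψ p⟫},
        ((m : ℝ))⁻¹ * ∑ i, (if σ i then (1 : ℝ) else -1) * h.1 (x i)) ≤
      (m : ℝ)⁻¹ * v * ‖Z σ‖ := by
    refine Real.iSup_le ?_ (by positivity)
    rintro ⟨f, w, hw, rfl⟩
    have hinner : ∑ i, (if σ i then (1 : ℝ) else -1) * ⟪w, ψ (x i)⟫ = ⟪w, Z σ⟫ := by
      simp only [hZ, inner_sum, real_inner_smul_right]
    simp only [hinner, mul_assoc]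
    gcongr
    exact (real_inner_le_norm _ _).trans (by gcongr)
  have hsum : ∑ i, ⟪ψ (x i), ψ (x i)⟫ ≤ m * u ^ 2 := by
    simpa using Finset.sum_le_sum fun i (_ : i ∈ Finset.univ) => hx i
  calc
    _ ≤ ((2 : ℝ) ^ m)⁻¹ * ∑ σ, (m : ℝ)⁻¹ * v * ‖Z σ‖ := by
      unfold empRad
      gcongr with σ
      exact hsup σ
    _ = (m : ℝ)⁻¹ * v * (((2 : ℝ) ^ m)⁻¹ * ∑ σ, ‖Z σ‖) := by
      rw [← Finset.mul_sum]
      ring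
    _ ≤ (m : ℝ)⁻¹ * v * √(m * u ^ 2) := by
      gcongr
      exact (mean_norm_signed_sum_le _).trans (Real.sqrt_le_sqrt hsum)
    _ = √(u ^ 2 * v ^ 2 / m) := by
      rw [← Real.sqrt_sq (show 0 ≤ (m : ℝ)⁻¹ * v by positivity),
        ← Real.sqrt_mul (by positivity)]
      congr 1
      rcases eq_or_ne (m : ℝ) 0 with h | h
      · simp [h]
      · field_simp
end

section
/- Let 𝓗 be a real Hilbert space and ψ : X → 𝓗 a feature map with kernel K(x,x′) = ⟨ψ(x), ψ(x′)⟩. Fix v > 0, ζ > 0 and a sample x_1,…,x_m ∈ X with Gram matrix 𝐊 = [K(x_i,x_j)]_{ij} and labels y_1,…,y_m ∈ {−1,1}. Then the infimum over w ∈ 𝓗 with ‖w‖ ≤ v of (1/m) ∑_{i=1}^m φ_{2,ζ}(y_i · ⟨w, ψ(x_i)⟩) equals the infimum over α ∈ ℝ^m with αᵀ𝐊α ≤ v² of (1/m) ∑_{i=1}^m φ_{2,ζ}(y_i · (𝐊α)_i). -/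
open scoped RealInnerProductSpace
open Matrix

/-- The Gram matrix acts on coefficients as pairing the linear combination with the family. -/
theorem inner_sum_smul_eq_mulVec {𝓗 ι : Type*} [NormedAddCommGroup 𝓗] [InnerProductSpace ℝ 𝓗]
    [Fintype ι] (u : ι → 𝓗) (K : Matrix ι ι ℝ) (hK : ∀ i j, K i j = ⟪u i, u j⟫)
    (α : ι → ℝ) (i : ι) : ⟪∑ j, α j • u j, u i⟫ = (K *ᵥ α) i := by
  simp only [sum_inner, real_inner_smul_left, mulVec, dotProduct, hK]
  exact Finset.sum_congr rfl fun j _ => by rw [real_inner_comm, mul_comm]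

/-- The Gram quadratic form is the squared norm of the linear combination. -/
theorem norm_sum_smul_sq_eq_dotProduct {𝓗 ι : Type*} [NormedAddCommGroup 𝓗]
    [InnerProductSpace ℝ 𝓗] [Fintype ι] (u : ι → 𝓗) (K : Matrix ι ι ℝ)
    (hK : ∀ i j, K i j = ⟪u i, u j⟫) (α : ι → ℝ) :
    ‖∑ j, α j • u j‖ ^ 2 = α ⬝ᵥ (K *ᵥ α) := by
  rw [← real_inner_self_eq_norm_sq, inner_sum, dotProduct]
  exact Finset.sum_congr rfl fun i _ => by
    rw [real_inner_smul_right, inner_sum_smul_eq_mulVec u K hK]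

/-- Every vector can be replaced by a linear combination of a finite family, of no larger norm,
with the same inner products against the family. -/
theorem exists_sum_smul_norm_le_inner_eq {𝓗 ι : Type*} [NormedAddCommGroup 𝓗]
    [InnerProductSpace ℝ 𝓗] [Fintype ι] (u : ι → 𝓗) (w : 𝓗) :
    ∃ α : ι → ℝ, ‖∑ j, α j • u j‖ ≤ ‖w‖ ∧ ∀ i, ⟪∑ j, α j • u j, u i⟫ = ⟪w, u i⟫ := by
  let S := Submodule.span ℝ (Set.range u)
  have : FiniteDimensional ℝ S := FiniteDimensional.span_of_finite ℝ (Set.finite_range u)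
  obtain ⟨α, hα⟩ := (Submodule.mem_span_range_iff_exists_fun ℝ).1 (S.starProjection_apply_mem w)
  refine ⟨α, hα ▸ S.norm_starProjection_apply_le w, fun i => ?_⟩
  have h := S.starProjection_inner_eq_zero w (u i) (Submodule.subset_span ⟨i, rfl⟩)
  rw [inner_sub_left, sub_eq_zero] at h
  rw [hα, h]

theorem statement5 {𝓗 X : Type*} [NormedAddCommGroup 𝓗] [InnerProductSpace ℝ 𝓗]
    [CompleteSpace 𝓗]
    (ψ : X → 𝓗) (v ζ : ℝ) (hv : 0 < v) (hζ : 0 < ζ)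
    (m : ℕ) (x : Fin m → X) (y : Fin m → ℝ) (hy : ∀ i, y i = -1 ∨ y i = 1)
    (K : Matrix (Fin m) (Fin m) ℝ) (hK : ∀ i j, K i j = ⟪ψ (x i), ψ (x j)⟫) :
    (⨅ w : {w : 𝓗 // ‖w‖ ≤ v},
        ((m : ℝ))⁻¹ * ∑ i, phi 2 ζ (y i * ⟪w.1, ψ (x i)⟫)) =
      ⨅ α : {α : Fin m → ℝ // α ⬝ᵥ (K *ᵥ α) ≤ v ^ 2},
        ((m : ℝ))⁻¹ * ∑ i, phi 2 ζ (y i * (K *ᵥ α.1) i) := by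
  refine congrArg sInf (Set.Subset.antisymm ?_ ?_)
  · rintro _ ⟨⟨w, hw⟩, rfl⟩
    obtain ⟨α, hα, hi⟩ := exists_sum_smul_norm_le_inner_eq (fun i => ψ (x i)) w
    refine ⟨⟨α, ?_⟩, ?_⟩
    · rw [← norm_sum_smul_sq_eq_dotProduct (fun i => ψ (x i)) K hK]
      exact pow_le_pow_left₀ (norm_nonneg _) (hα.trans hw) 2
    · simp only [← inner_sum_smul_eq_mulVec (fun i => ψ (x i)) K hK, hi]
  · rintro _ ⟨⟨α, hα⟩, rfl⟩
    refine ⟨⟨∑ j, α j • ψ (x j), ?_⟩, ?_⟩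
    · rw [← norm_sum_smul_sq_eq_dotProduct (fun i => ψ (x i)) K hK] at hα
      exact (sq_le_sq₀ (norm_nonneg _) hv.le).1 hα
    · simp only [← inner_sum_smul_eq_mulVec (fun i => ψ (x i)) K hK]
end

section
/- Let X be a metric space, h : X → ℝ, ξ > 0, and y ∈ {−1,1}. Define the events A = {(x,y) : ∃ x̃ ∈ X with d(x̃,x) ≤ ξ and y·h(x̃) ≤ 0}, N = {(x,y) : y·h(x) ≤ 0}, and B = {(x,y) : (∃ x̃ ∈ X with d(x̃,x) ≤ ξ and h(x)·h(x̃) ≤ 0) and y·h(x) > 0}. Then A = N ∪ B and N ∩ B = ∅. Consequently, for any probability measure P on X × {−1,1} under which these three sets are measurable, P(A) = P(N) + P(B); that is, the robust classification error decomposes as the sum of the natural classification error and the boundary classification error. -/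
open MeasureTheory

/-- If `a * b` is positive then `a` and `b` have the same sign, so multiplying by either gives the
same sign condition. -/
theorem mul_nonpos_iff_of_mul_pos {a b c : ℝ} (hab : 0 < a * b) : b * c ≤ 0 ↔ a * c ≤ 0 := by
  rcases pos_and_pos_or_neg_and_neg_of_mul_pos hab with ⟨ha, hb⟩ | ⟨ha, hb⟩
  · rw [mul_nonpos_iff_pos_imp_nonpos, mul_nonpos_iff_pos_imp_nonpos]
    simp [ha, hb, ha.le, hb.le]
  · rw [mul_nonpos_iff_neg_imp_nonneg, mul_nonpos_iff_neg_imp_nonneg]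
    simp [ha, hb, ha.le, hb.le]

theorem statement9 {X : Type*} [MetricSpace X] [MeasurableSpace X]
    (h : X → ℝ) (ξ : ℝ) (hξ : 0 < ξ)
    (A N B : Set (X × ({-1, 1} : Set ℝ)))
    (hA : A = {p | ∃ xt : X, dist xt p.1 ≤ ξ ∧ (p.2 : ℝ) * h xt ≤ 0})
    (hN : N = {p | (p.2 : ℝ) * h p.1 ≤ 0})
    (hB : B = {p | (∃ xt : X, dist xt p.1 ≤ ξ ∧ h p.1 * h xt ≤ 0) ∧ 0 < (p.2 : ℝ) * h p.1}) :
    A = N ∪ B ∧ N ∩ B = ∅ ∧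
      ∀ P : Measure (X × ({-1, 1} : Set ℝ)), IsProbabilityMeasure P →
        MeasurableSet N → MeasurableSet B → P A = P N + P B := by
  have hunion : A = N ∪ B := by
    subst hA hN hB
    ext p
    simp only [Set.mem_ofPred_eq, Set.mem_union]
    rcases le_or_gt ((p.2 : ℝ) * h p.1) 0 with hp | hp
    · exact iff_of_true ⟨p.1, by simpa using hξ.le, hp⟩ (Or.inl hp)
    · simp only [mul_nonpos_iff_of_mul_pos hp, hp, hp.not_ge, false_or, and_true]
  have hdisj : Disjoint N B := by
    subst hN hB
    exact Set.disjoint_left.2 fun p hp hq => hq.2.not_ge hp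
  exact ⟨hunion, hdisj.inter_eq, fun P _ _ hBm => by rw [hunion, measure_union hdisj hBm]⟩
end

section
/- Let E be a real normed space, a a continuous linear functional on E with dual norm ‖a‖, x ∈ E, b ∈ ℝ, and ξ ≥ 0. Then sup over δ ∈ E with ‖δ‖ ≤ ξ of log(1 + exp(−(a(x + δ) + b))) equals log(1 + exp(−(a(x) + b) + ξ‖a‖)), and sup over δ ∈ E with ‖δ‖ ≤ ξ of log(1 + exp(a(x + δ) + b)) equals log(1 + exp(a(x) + b + ξ‖a‖)). -/
/-- The supremum of a continuous linear functional over the closed ball of radius `ξ` is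
`ξ` times its dual norm. -/
theorem ContinuousLinearMap.isLUB_range_closedBall {E : Type*} [NormedAddCommGroup E]
    [NormedSpace ℝ E] (a : E →L[ℝ] ℝ) {ξ : ℝ} (hξ : 0 ≤ ξ) :
    IsLUB (Set.range fun δ : {δ : E // ‖δ‖ ≤ ξ} => a δ.1) (ξ * ‖a‖) := by
  constructor
  · rintro _ ⟨⟨δ, hδ⟩, rfl⟩
    calc a δ ≤ ‖a δ‖ := Real.le_norm_self _
      _ ≤ ‖a‖ * ‖δ‖ := a.le_opNorm δ
      _ ≤ ξ * ‖a‖ := by rw [mul_comm]; gcongr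
  · intro M hM
    have hle : ∀ δ : E, ‖δ‖ ≤ ξ → a δ ≤ M := fun δ hδ => hM ⟨⟨δ, hδ⟩, rfl⟩
    have hM0 : 0 ≤ M := by simpa using hle 0 (by simpa using hξ)
    have hnorm : ‖ξ • a‖ ≤ M := by
      refine ContinuousLinearMap.opNorm_le_of_unit_norm hM0 fun z hz => ?_
      have hz' : ‖ξ • z‖ ≤ ξ := by simp [norm_smul, hz, abs_of_nonneg hξ]
      have h₁ := hle (ξ • z) hz'
      have h₂ := hle (-(ξ • z)) (by rwa [norm_neg])
      rw [map_neg] at h₂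
      rw [smul_apply, ← map_smul, Real.norm_eq_abs, abs_le]
      exact ⟨by linarith, h₁⟩
    rwa [norm_smul, Real.norm_of_nonneg hξ] at hnorm

theorem ContinuousLinearMap.iSup_log_one_add_exp_closedBall {E : Type*} [NormedAddCommGroup E]
    [NormedSpace ℝ E] (a : E →L[ℝ] ℝ) (c : ℝ) {ξ : ℝ} (hξ : 0 ≤ ξ) :
    (⨆ δ : {δ : E // ‖δ‖ ≤ ξ}, Real.log (1 + Real.exp (c + a δ.1))) =
      Real.log (1 + Real.exp (c + ξ * ‖a‖)) := by
  have : Nonempty {δ : E // ‖δ‖ ≤ ξ} := ⟨⟨0, by simpa using hξ⟩⟩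
  have hlub := a.isLUB_range_closedBall hξ
  have hmono : Monotone fun t : ℝ => Real.log (1 + Real.exp (c + t)) := fun s t hst =>
    Real.log_le_log (by positivity) (by gcongr)
  have hcont : Continuous fun t : ℝ => Real.log (1 + Real.exp (c + t)) :=
    Continuous.log (by fun_prop) fun t => by positivity
  have hmap := hmono.map_ciSup_of_continuousAt hcont.continuousAt hlub.bddAbove
  rw [hlub.ciSup_eq] at hmap
  exact hmap.symm

theorem statement15 {E : Type*} [NormedAddCommGroup E] [NormedSpace ℝ E]
    (a : E →L[ℝ] ℝ) (x : E) (b ξ : ℝ) (hξ : 0 ≤ ξ) :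
    (⨆ δ : {δ : E // ‖δ‖ ≤ ξ}, Real.log (1 + Real.exp (-(a (x + δ.1) + b)))) =
        Real.log (1 + Real.exp (-(a x + b) + ξ * ‖a‖)) ∧
      (⨆ δ : {δ : E // ‖δ‖ ≤ ξ}, Real.log (1 + Real.exp (a (x + δ.1) + b))) =
        Real.log (1 + Real.exp (a x + b + ξ * ‖a‖)) := by
  constructor
  · rw [← norm_neg a, ← (-a).iSup_log_one_add_exp_closedBall _ hξ]
    congr! 5 with δ
    rw [map_add, neg_apply]
    ring
  · rw [← a.iSup_log_one_add_exp_closedBall _ hξ]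
    congr! 5 with δ
    rw [map_add]
    ring
end
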